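/- arXiv:2311.17679 — 2 statements merged into one kernel-verified Lean document; each statement's English description precedes it below -/
import Mathlib

section
/- Let A = k[X,Y,Z]/(XY, YZ, ZX) with images x,y,z of the variables, and I = (x, y², z³). Then the density function f_{A,{Iⁿ}}(t) = lim_n dim_k((Iⁿ)_{⌊tn⌋})/(n⁰/1!) (here dim A = 1, so f is just the limit of dim_k((Iⁿ)_{⌊tn⌋})) equals 0 for t < 1, equals 1 for 1 ≤ t < 2, equals 2 for 2 ≤ t < 3, and equals 3 for t ≥ 3. In particular f is discontinuous at t = 1, 2, 3. -/
open Filter MvPolynomial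

/-- The ideal `(XY, YZ, ZX)` of `k[X,Y,Z]`. -/
noncomputable def triIdeal (k : Type*) [Field k] :
    Ideal (MvPolynomial (Fin 3) k) :=
  Ideal.span {X 0 * X 1, X 1 * X 2, X 2 * X 0}

/-- The lift `(X, Y², Z³)` of the ideal `I = (x, y², z³)` of
`A = k[X,Y,Z]/(XY,YZ,ZX)`. -/
noncomputable def liftIdeal (k : Type*) [Field k] :
    Ideal (MvPolynomial (Fin 3) k) :=
  Ideal.span {X 0, X 1 ^ 2, X 2 ^ 3}

/-- The degree-`m` graded piece of `Iⁿ` inside `A = k[X,Y,Z]/(XY,YZ,ZX)`,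
realized as the image of the degree-`m` part of `(X,Y²,Z³)ⁿ + (XY,YZ,ZX)`
under the quotient map. -/
noncomputable def quotPiece (k : Type*) [Field k] (n m : ℕ) :
    Submodule k (MvPolynomial (Fin 3) k ⧸ triIdeal k) :=
  Submodule.map (Ideal.Quotient.mkₐ k (triIdeal k)).toLinearMap
    (Submodule.restrictScalars k (liftIdeal k ^ n ⊔ triIdeal k) ⊓
      homogeneousSubmodule (Fin 3) k m)

noncomputable def axisMap (k : Type*) [Field k] (i : Fin 3) :
    MvPolynomial (Fin 3) k →ₐ[k] Polynomial k :=
  aeval (fun j => if j = i then Polynomial.X else 0)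

theorem axisMap_X (k : Type*) [Field k] (i j : Fin 3) :
    axisMap k i (X j) = if j = i then Polynomial.X else 0 := by
  simp [axisMap]

theorem tri_le_ker (k : Type*) [Field k] (i : Fin 3) {p : MvPolynomial (Fin 3) k}
    (hp : p ∈ triIdeal k) : axisMap k i p = 0 := by
  have : triIdeal k ≤ RingHom.ker (axisMap k i) := by
    rw [triIdeal, Ideal.span_le]
    rintro q (rfl | rfl | rfl) <;> fin_cases i <;> simp [RingHom.mem_ker, axisMap_X]
  exact this hp

theorem mul_mem_tri (k : Type*) [Field k] {i j : Fin 3} (h : i ≠ j) :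
    (X i * X j : MvPolynomial (Fin 3) k) ∈ triIdeal k := by
  have h1 : (X 0 * X 1 : MvPolynomial (Fin 3) k) ∈ triIdeal k :=
    Ideal.subset_span (by simp)
  have h2 : (X 1 * X 2 : MvPolynomial (Fin 3) k) ∈ triIdeal k :=
    Ideal.subset_span (by simp)
  have h3 : (X 2 * X 0 : MvPolynomial (Fin 3) k) ∈ triIdeal k :=
    Ideal.subset_span (by simp)
  have h1' := h1
  have h2' := h2
  have h3' := h3
  rw [mul_comm] at h1' h2' h3'
  fin_cases i <;> fin_cases j <;> first | exact absurd rfl h | assumption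

theorem lift_pow_dvd (k : Type*) [Field k] (i : Fin 3) (n : ℕ) {p : MvPolynomial (Fin 3) k}
    (hp : p ∈ liftIdeal k ^ n ⊔ triIdeal k) :
    (Polynomial.X : Polynomial k) ^ ((i.val + 1) * n) ∣ axisMap k i p := by
  obtain ⟨a, ha, b, hb, rfl⟩ := Submodule.mem_sup.1 hp
  rw [map_add, tri_le_ker k i hb, add_zero, ← Ideal.mem_span_singleton, pow_mul,
    ← Ideal.span_singleton_pow]
  have h : (liftIdeal k).map (axisMap k i) ≤ Ideal.span {Polynomial.X ^ (i.val + 1)} := by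
    rw [liftIdeal, Ideal.map_span, Ideal.span_le]
    rintro q ⟨r, (rfl | rfl | rfl), rfl⟩ <;> fin_cases i <;>
      simp [axisMap_X, Ideal.mem_span_singleton]
  have h2 := Ideal.mem_map_of_mem (axisMap k i) ha
  rw [Ideal.map_pow] at h2
  exact Ideal.pow_right_mono h n h2

theorem mk_monomial (k : Type*) [Field k] (m : ℕ) (hm : 1 ≤ m) (d : Fin 3 →₀ ℕ)
    (hd : d.degree = m) (c : k) :
    Ideal.Quotient.mkₐ k (triIdeal k) (monomial d c) =
      ∑ i : Fin 3, ((axisMap k i (monomial d c)).coeff m) •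
        Ideal.Quotient.mkₐ k (triIdeal k) (X i ^ m) := by
  by_cases h : ∃ i j, i ≠ j ∧ d i ≠ 0 ∧ d j ≠ 0
  · obtain ⟨i, j, hij, hi, hj⟩ := h
    have hmem : monomial d c ∈ triIdeal k := by
      refine Ideal.mem_of_dvd _ ?_ (mul_mem_tri k hij)
      have : (X i * X j : MvPolynomial (Fin 3) k) =
          monomial (Finsupp.single i 1 + Finsupp.single j 1) 1 := by
        simp [X, monomial_mul]
      rw [this, monomial_dvd_monomial]
      refine ⟨Or.inr ?_, one_dvd _⟩
      intro l
      simp only [Finsupp.add_apply, Finsupp.single_apply]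
      split_ifs with h1 h2 h2
      · exact absurd (h1.trans h2.symm) hij
      · subst h1; omega
      · subst h2; omega
      · omega
    have h0 : Ideal.Quotient.mkₐ k (triIdeal k) (monomial d c) = 0 := by
      simpa using Ideal.Quotient.eq_zero_iff_mem.2 hmem
    rw [h0]
    simp [tri_le_ker k _ hmem]
  · push Not at h
    have : ∃ i, d i ≠ 0 := by
      by_contra hc
      push Not at hc
      have : d = 0 := Finsupp.ext hc
      subst this
      simp at hd
      omega
    obtain ⟨i, hi⟩ := this
    have hds : d = Finsupp.single i (d i) := by
      ext l
      by_cases hl : i = l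
      · subst hl; simp
      · rw [Finsupp.single_eq_of_ne (Ne.symm hl)]
        exact h i l hl hi
    rw [hds, Finsupp.degree_single] at hd
    rw [hd] at hds
    have hmon : monomial d c = c • (X i ^ m : MvPolynomial (Fin 3) k) := by
      rw [hds, X_pow_eq_monomial, smul_monomial]; simp
    rw [hmon, Finset.sum_eq_single i]
    · simp [axisMap_X]
    · intro j _ hj
      simp [axisMap_X, hj.symm, zero_pow (by omega : m ≠ 0)]
    · simp

theorem mk_homog (k : Type*) [Field k] (m : ℕ) (hm : 1 ≤ m) (p : MvPolynomial (Fin 3) k)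
    (hp : p ∈ homogeneousSubmodule (Fin 3) k m) :
    Ideal.Quotient.mkₐ k (triIdeal k) p =
      ∑ i : Fin 3, ((axisMap k i p).coeff m) •
        Ideal.Quotient.mkₐ k (triIdeal k) (X i ^ m) := by
  have key : ∀ s : Finset (Fin 3 →₀ ℕ), (∀ d ∈ s, d.degree = m) →
      Ideal.Quotient.mkₐ k (triIdeal k) (∑ d ∈ s, monomial d (coeff d p)) =
      ∑ i : Fin 3, ((axisMap k i (∑ d ∈ s, monomial d (coeff d p))).coeff m) •
        Ideal.Quotient.mkₐ k (triIdeal k) (X i ^ m) := by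
    intro s hs
    simp only [map_sum, Polynomial.finsetSum_coeff, Finset.sum_smul]
    rw [Finset.sum_comm]
    refine Finset.sum_congr rfl fun d hd => ?_
    exact mk_monomial k m hm d (hs d hd) _
  have := key p.support (fun d hd => by
    have h := (mem_homogeneousSubmodule m p).1 hp (mem_support_iff.1 hd)
    rw [Finsupp.degree_eq_weight_one]; exact h)
  rwa [support_sum_monomial_coeff] at this

theorem quotPiece_eq (k : Type*) [Field k] (n m : ℕ) (hm : 1 ≤ m) :
    quotPiece k n m = Submodule.span k (Set.range
      (fun i : {i : Fin 3 // (i.val + 1) * n ≤ m} =>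
        Ideal.Quotient.mkₐ k (triIdeal k) (X i.1 ^ m))) := by
  apply le_antisymm
  · rintro _ ⟨p, ⟨hp1, hp2⟩, rfl⟩
    change Ideal.Quotient.mkₐ k (triIdeal k) p ∈ _
    rw [mk_homog k m hm p hp2]
    refine Submodule.sum_mem _ fun i _ => ?_
    by_cases hi : (i.val + 1) * n ≤ m
    · exact Submodule.smul_mem _ _ (Submodule.subset_span ⟨⟨i, hi⟩, rfl⟩)
    · have := lift_pow_dvd k i n hp1
      rw [Polynomial.X_pow_dvd_iff] at this
      rw [this m (by omega), zero_smul]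
      exact Submodule.zero_mem _
  · rw [Submodule.span_le]
    rintro _ ⟨⟨i, hi⟩, rfl⟩
    refine ⟨X i ^ m, ⟨?_, ?_⟩, rfl⟩
    · have hg : (X i ^ (i.val + 1) : MvPolynomial (Fin 3) k) ∈ liftIdeal k := by
        apply Ideal.subset_span
        fin_cases i <;> simp
      have h1 : (X i ^ ((i.val + 1) * n) : MvPolynomial (Fin 3) k) ∈ liftIdeal k ^ n := by
        rw [pow_mul]; exact Ideal.pow_mem_pow hg n
      exact Ideal.mem_sup_left (Ideal.mem_of_dvd _ (pow_dvd_pow _ hi) h1)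
    · exact (mem_homogeneousSubmodule _ _).2 (isHomogeneous_X_pow i m)

theorem finrank_quotPiece (k : Type*) [Field k] (n m : ℕ) (hm : 1 ≤ m) :
    Module.finrank k (quotPiece k n m) =
      Fintype.card {i : Fin 3 // (i.val + 1) * n ≤ m} := by
  rw [quotPiece_eq k n m hm]
  apply finrank_span_eq_card
  rw [Fintype.linearIndependent_iff]
  intro g hg j
  have h1 : (∑ i, g i • (X i.1 ^ m : MvPolynomial (Fin 3) k)) ∈ triIdeal k := by
    rw [← Ideal.Quotient.eq_zero_iff_mem, ← hg]
    change Ideal.Quotient.mkₐ k (triIdeal k) _ = _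
    simp only [map_sum, map_smul]
  have h2 := congrArg (fun q => Polynomial.coeff q m) (tri_le_ker k j.1 h1)
  simp only [map_sum, map_smul, map_pow, axisMap_X, Polynomial.finsetSum_coeff] at h2
  rw [Finset.sum_eq_single j] at h2
  · simpa using h2
  · intro b _ hb
    have : b.1 ≠ j.1 := fun h => hb (Subtype.ext h)
    simp [this, zero_pow (by omega : m ≠ 0)]
  · simp

theorem card_eq (n m : ℕ) : Fintype.card {i : Fin 3 // (i.val + 1) * n ≤ m} =
    (if n ≤ m then 1 else 0) + (if 2 * n ≤ m then 1 else 0) + (if 3 * n ≤ m then 1 else 0) := by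
  rw [Fintype.card_subtype, Finset.card_filter, Fin.sum_univ_three]
  simp

theorem quotPiece_zero (k : Type*) [Field k] (n : ℕ) (hn : 1 ≤ n) :
    Module.finrank k (quotPiece k n 0) = 0 := by
  have : quotPiece k n 0 = ⊥ := by
    rw [eq_bot_iff]
    rintro _ ⟨p, ⟨hp1, hp2⟩, rfl⟩
    have hp3 : p.IsHomogeneous 0 := (mem_homogeneousSubmodule _ _).1 hp2
    have hC : p = C (coeff 0 p) := by
      rw [← totalDegree_eq_zero_iff_eq_C]
      exact Nat.le_zero.1 hp3.totalDegree_le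
    have h := lift_pow_dvd k 0 n hp1
    rw [Polynomial.X_pow_dvd_iff] at h
    have h0 := h 0 (by simp; omega)
    rw [hC] at h0 ⊢
    have hc : coeff 0 p = 0 := by
      rw [← algebraMap_eq, AlgHom.commutes] at h0
      simpa using h0
    rw [hc]; simp
  rw [this]; simp

theorem finrank_formula (k : Type*) [Field k] (n m : ℕ) (hn : 1 ≤ n) :
    Module.finrank k (quotPiece k n m) =
    (if n ≤ m then 1 else 0) + (if 2 * n ≤ m then 1 else 0) + (if 3 * n ≤ m then 1 else 0) := by
  rcases Nat.eq_zero_or_pos m with rfl | hm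
  · rw [quotPiece_zero k n hn, if_neg (by omega), if_neg (by omega), if_neg (by omega)]
  · rw [finrank_quotPiece k n m hm, card_eq]

theorem le_floor_iff (t : ℝ) (ht : 0 ≤ t) (n c : ℕ) (hn : 1 ≤ n) :
    c * n ≤ (⌊t * n⌋).toNat ↔ (c : ℝ) ≤ t := by
  have hn' : (0 : ℝ) < n := by exact_mod_cast hn
  have h0 : 0 ≤ ⌊t * n⌋ := Int.floor_nonneg.2 (by positivity)
  rw [← Nat.cast_le (α := ℤ), Int.toNat_of_nonneg h0, Int.le_floor]
  push_cast
  exact mul_le_mul_iff_left₀ hn'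

theorem tendsto_aux (k : Type*) [Field k] (t : ℝ) (ht : 0 ≤ t) (a : ℝ)
    (ha : (((if (1 : ℝ) ≤ t then 1 else 0) + (if (2 : ℝ) ≤ t then 1 else 0) +
      (if (3 : ℝ) ≤ t then 1 else 0) : ℕ) : ℝ) = a) :
    Filter.Tendsto (fun n : ℕ =>
      (Module.finrank k ↥(quotPiece k n (⌊t * n⌋).toNat) : ℝ)) Filter.atTop (nhds a) := by
  apply tendsto_const_nhds.congr'
  filter_upwards [eventually_ge_atTop 1] with n hn
  have h1 := le_floor_iff t ht n 1 hn
  have h2 := le_floor_iff t ht n 2 hn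
  have h3 := le_floor_iff t ht n 3 hn
  rw [one_mul] at h1
  push_cast at h1 h2 h3
  rw [finrank_formula k n _ hn, ← ha]
  simp only [h1, h2, h3]

/-- for `A = k[X,Y,Z]/(XY,YZ,ZX)` (a one-dimensional standard
graded ring) and `I = (x, y², z³)`, the density function
`f(t) = lim_n dim_k((Iⁿ)_{⌊tn⌋})` equals `0` for `t < 1`, `1` for `1 ≤ t < 2`,
`2` for `2 ≤ t < 3`, and `3` for `t ≥ 3` (hence is discontinuous at
`t = 1, 2, 3`). -/
theorem density_function_of_nondomain_example
    (k : Type*) [Field k] :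
    ∀ t : ℝ,
      (0 ≤ t → t < 1 →
        Filter.Tendsto (fun n : ℕ =>
          (Module.finrank k ↥(quotPiece k n (⌊t * n⌋).toNat) : ℝ))
          Filter.atTop (nhds 0)) ∧
      (1 ≤ t → t < 2 →
        Filter.Tendsto (fun n : ℕ =>
          (Module.finrank k ↥(quotPiece k n (⌊t * n⌋).toNat) : ℝ))
          Filter.atTop (nhds 1)) ∧
      (2 ≤ t → t < 3 →
        Filter.Tendsto (fun n : ℕ =>
          (Module.finrank k ↥(quotPiece k n (⌊t * n⌋).toNat) : ℝ))
          Filter.atTop (nhds 2)) ∧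
      (3 ≤ t →
        Filter.Tendsto (fun n : ℕ =>
          (Module.finrank k ↥(quotPiece k n (⌊t * n⌋).toNat) : ℝ))
          Filter.atTop (nhds 3)) := by
  intro t
  refine ⟨fun h0 h1 => ?_, fun h0 h1 => ?_, fun h0 h1 => ?_, fun h0 => ?_⟩
  · apply tendsto_aux k t h0
    rw [if_neg (by linarith), if_neg (by linarith), if_neg (by linarith)]; norm_num
  · apply tendsto_aux k t (by linarith)
    rw [if_pos (by linarith), if_neg (by linarith), if_neg (by linarith)]; norm_num
  · apply tendsto_aux k t (by linarith)
    rw [if_pos (by linarith), if_pos (by linarith), if_neg (by linarith)]; norm_num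
  · apply tendsto_aux k t (by linarith)
    rw [if_pos (by linarith), if_pos (by linarith), if_pos (by linarith)]; norm_num
end

section
/- Let A be a two-dimensional standard graded domain over a field k and I_1 ⊆ I_2 homogeneous ideals. In A = k[X,Y] (a 2-variable polynomial ring), if the density functions satisfy f_{A,{I_1ⁿ}}(x) = f_{A,{I_2ⁿ}}(x) for all real x ≥ 0, then I_1 ⊆ I_2 is a reduction, i.e., I_2 is integral over I_1. -/
open Filter MvPolynomial

/-- The degree-`m` graded piece of an ideal `J` of `k[X,Y]`. -/
noncomputable def polyPiece (k : Type*) [Field k]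
    (J : Ideal (MvPolynomial (Fin 2) k)) (m : ℕ) :
    Submodule k (MvPolynomial (Fin 2) k) :=
  Submodule.restrictScalars k J ⊓ homogeneousSubmodule (Fin 2) k m


lemma det_trick {A : Type*} [CommRing A] [IsDomain A] [IsNoetherianRing A]
    (I M : Ideal A) (f : A) (hM : ∀ m ∈ M, f * m ∈ I * M) (hne : M ≠ ⊥) :
    ∃ r : ℕ, ∀ J : Ideal A, I ≤ J → f ∈ J → f ^ (r + 1) ∈ I * J ^ r := by
  let F : Module.End A M := LinearMap.lsmul A M f
  obtain ⟨p, hp, -, hc, h0⟩ :=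
    LinearMap.exists_monic_and_natDegree_eq_and_coeff_mem_pow_and_aeval_eq_zero A F I (by
      rintro _ ⟨x, rfl⟩
      have h1 := hM x x.2
      have h2 : (I • (⊤ : Submodule A M)).map M.subtype = I * M := by
        rw [Submodule.map_smul'']; simp
      rw [← h2] at h1
      obtain ⟨y, hy, hy'⟩ := h1
      have : F x = y := by
        apply Subtype.ext
        rw [← Submodule.subtype_apply y, hy']
        rfl
      rw [this]; exact hy)
  have key : p.eval f = 0 := by
    obtain ⟨z, hz, hz0⟩ := Submodule.exists_mem_ne_zero_of_ne_bot hne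
    have h1 : Polynomial.aeval F p = LinearMap.lsmul A M (p.eval f) := by
      have : F = algebraMap A (Module.End A M) f := rfl
      rw [this, Polynomial.aeval_algebraMap_apply]
      rfl
    have h2 := congrArg (fun G : Module.End A M => (G ⟨z, hz⟩ : A)) (h1.symm.trans h0)
    have h3 : p.eval f * z = 0 := by simpa using h2
    exact (mul_eq_zero.1 h3).resolve_right hz0
  rcases hd : p.natDegree with _ | r
  · rw [hp.natDegree_eq_zero.1 hd] at key
    simp at key
  refine ⟨r, fun J hIJ hf => ?_⟩
  rw [Polynomial.eval_eq_sum_range, Finset.sum_range_succ, hp.coeff_natDegree, one_mul, hd] at key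
  rw [eq_neg_of_add_eq_zero_right key]
  refine neg_mem (sum_mem fun i hi => ?_)
  have hi : i < r + 1 := Finset.mem_range.1 hi
  have h1 := hc i
  rw [hd, show r + 1 - i = (r - i) + 1 by omega, pow_succ'] at h1
  have h2 : p.coeff i * f ^ i ∈ (I * I ^ (r - i)) * J ^ i :=
    Ideal.mul_mem_mul h1 (Ideal.pow_mem_pow hf i)
  have h3 : (I * I ^ (r - i)) * J ^ i ≤ I * J ^ r := by
    rw [mul_assoc]
    refine Ideal.mul_mono le_rfl ?_
    calc I ^ (r - i) * J ^ i ≤ J ^ (r - i) * J ^ i := Ideal.mul_mono (Ideal.pow_right_mono hIJ _) le_rfl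
      _ = J ^ r := by rw [← pow_add]; congr 1; omega
  exact h3 h2

lemma reduction_of_gens {A : Type*} [CommRing A] (I J : Ideal A) (hIJ : I ≤ J) (s : Finset A)
    (hs : J = Ideal.span s) (h : ∀ f ∈ s, ∃ r : ℕ, f ^ (r + 1) ∈ I * J ^ r) :
    ∃ n : ℕ, J ^ (n + 1) = I * J ^ n := by
  classical
  have key : ∀ u : Finset A, u ⊆ s → ∃ n : ℕ, (Ideal.span (u : Set A)) ^ (n + 1) ≤ I * J ^ n := by
    intro u
    induction u using Finset.induction_on with
    | empty => intro _; exact ⟨0, by simp⟩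
    | insert f u hfu ih =>
      intro hu
      obtain ⟨n, hn⟩ := ih (fun x hx => hu (Finset.mem_insert_of_mem hx))
      obtain ⟨r, hr⟩ := h f (hu (Finset.mem_insert_self _ _))
      refine ⟨n + r + 1, ?_⟩
      have hJ1 : Ideal.span {f} ≤ J := by
        rw [hs]; apply Ideal.span_mono; simpa using hu (Finset.mem_insert_self _ _)
      have hJ2 : Ideal.span (u : Set A) ≤ J := by
        rw [hs]; apply Ideal.span_mono; exact_mod_cast fun x hx => hu (Finset.mem_insert_of_mem hx)
      have hr' : Ideal.span {f} ^ (r + 1) ≤ I * J ^ r := by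
        rw [Ideal.span_singleton_pow, Ideal.span_singleton_le_iff_mem]; exact hr
      rw [Finset.coe_insert, Ideal.span_insert, ← Submodule.add_eq_sup, add_pow]
      rw [Ideal.sum_eq_sup]
      refine Finset.sup_le fun i hi => ?_
      refine Ideal.mul_le_left.trans ?_
      have hi : i < n + r + 1 + 1 + 1 := Finset.mem_range.1 hi
      by_cases hir : r + 1 ≤ i
      · obtain ⟨j, rfl⟩ := Nat.exists_eq_add_of_le hir
        rw [pow_add (Ideal.span {f})]
        calc _ ≤ (I * J ^ r * J ^ j) * J ^ (n + r + 1 + 1 - (r + 1 + j)) :=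
              Ideal.mul_mono (Ideal.mul_mono hr' (Ideal.pow_right_mono hJ1 _)) (Ideal.pow_right_mono hJ2 _)
          _ = I * J ^ (n + r + 1) := by
            rw [mul_assoc, mul_assoc, ← pow_add, ← pow_add]; congr 2; omega
      · obtain ⟨j, hj⟩ : ∃ j, n + r + 1 + 1 - i = n + 1 + j := Nat.exists_eq_add_of_le (by omega)
        rw [hj, pow_add (Ideal.span (u : Set A))]
        calc _ ≤ J ^ i * (I * J ^ n * J ^ j) :=
              Ideal.mul_mono (Ideal.pow_right_mono hJ1 _) (Ideal.mul_mono hn (Ideal.pow_right_mono hJ2 _))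
          _ = I * (J ^ i * J ^ n * J ^ j) := by ring
          _ = I * J ^ (n + r + 1) := by
            rw [← pow_add, ← pow_add]; congr 2; omega
  obtain ⟨n, hn⟩ := key s le_rfl
  refine ⟨n, le_antisymm (hs ▸ hn) ?_⟩
  rw [pow_succ']
  exact Ideal.mul_mono hIJ le_rfl

lemma integral_of_charts {A : Type*} [CommRing A] [IsDomain A] [IsNoetherianRing A]
    (I : Ideal A) (f x y : A) (hx : x ≠ 0) (N1 N2 c1 c2 : ℕ)
    (hN1 : 0 < N1) (hN2 : 0 < N2)
    (h1 : x ^ c1 * f ^ N1 ∈ I ^ N1 * Ideal.span {x, y} ^ c1)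
    (h2 : y ^ c2 * f ^ N2 ∈ I ^ N2 * Ideal.span {x, y} ^ c2) :
    ∃ r : ℕ, ∀ J : Ideal A, I ≤ J → f ∈ J → f ^ (r + 1) ∈ I * J ^ r := by
  set m : Ideal A := Ideal.span {x, y} with hm
  have hxm : x ∈ m := Ideal.subset_span (by simp)
  have hym : y ∈ m := Ideal.subset_span (by simp)
  have gen : ∀ (z : A), z ∈ m → ∀ (N M c e : ℕ), z ^ c * f ^ N ∈ I ^ N * m ^ c →
      z ^ (c * M + e) * f ^ (N * M) ∈ I ^ (N * M) * m ^ (c * M + e) := by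
    intro z hz N M c e h
    have := Ideal.mul_mem_mul (Ideal.pow_mem_pow h M) (Ideal.pow_mem_pow hz e)
    have e1 : z ^ (c * M + e) * f ^ (N * M) = (z ^ c * f ^ N) ^ M * z ^ e := by
      rw [mul_pow, ← pow_mul, ← pow_mul, pow_add]; ring
    rw [e1]
    convert this using 1
    · rw [mul_pow, ← pow_mul, ← pow_mul, pow_add, mul_assoc]
  obtain ⟨N, c, hN, g1, g2⟩ : ∃ N c : ℕ, 0 < N ∧ x ^ c * f ^ N ∈ I ^ N * m ^ c ∧
      y ^ c * f ^ N ∈ I ^ N * m ^ c := by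
    refine ⟨N1 * N2, c1 * N2 + c2 * N1, by positivity, gen x hxm _ _ _ _ h1, ?_⟩
    have := gen y hym _ N1 _ (c1 * N2) h2
    rwa [mul_comm N2, add_comm] at this
  have hM : ∀ z ∈ m ^ (c + c), f ^ N * z ∈ I ^ N * m ^ (c + c) := by
    have : Ideal.span {f ^ N} * m ^ (c + c) ≤ I ^ N * m ^ (c + c) := by
      conv_lhs => rw [hm, Ideal.span_insert, ← Submodule.add_eq_sup, add_pow]
      rw [Finset.mul_sum, Ideal.sum_eq_sup]
      refine Finset.sup_le fun i hi => ?_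
      have hi : i < c + c + 1 := Finset.mem_range.1 hi
      refine (Ideal.mul_mono le_rfl Ideal.mul_le_left).trans ?_
      rw [Ideal.span_singleton_pow, Ideal.span_singleton_pow, Ideal.span_singleton_mul_span_singleton,
        Ideal.span_singleton_mul_span_singleton, Ideal.span_singleton_le_iff_mem]
      by_cases hic : c ≤ i
      · obtain ⟨j, rfl⟩ := Nat.exists_eq_add_of_le hic
        have := Ideal.mul_mem_mul g1 (Ideal.mul_mem_mul (Ideal.pow_mem_pow hxm j)
          (Ideal.pow_mem_pow hym (c + c - (c + j))))
        convert this using 1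
        · rw [mul_assoc, ← pow_add, ← pow_add]; congr 2; omega
        · ring
      · obtain ⟨j, hj⟩ : ∃ j, c + c - i = c + j := Nat.exists_eq_add_of_le (by omega)
        rw [hj]
        have := Ideal.mul_mem_mul g2 (Ideal.mul_mem_mul (Ideal.pow_mem_pow hxm i)
          (Ideal.pow_mem_pow hym j))
        convert this using 1
        · rw [mul_assoc, ← pow_add, ← pow_add]; congr 2; omega
        · ring
    intro z hz
    exact this (Ideal.mul_mem_mul (Ideal.mem_span_singleton_self _) hz)
  have hne : m ^ (c + c) ≠ ⊥ := by
    intro h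
    have := Ideal.pow_mem_pow hxm (c + c)
    rw [h] at this
    exact pow_ne_zero _ hx this
  obtain ⟨r, hr⟩ := det_trick (I ^ N) (m ^ (c + c)) (f ^ N) hM hne
  refine ⟨N * r + (N - 1), fun J hIJ hf => ?_⟩
  have := hr (J ^ N) (Ideal.pow_right_mono hIJ _) (Ideal.pow_mem_pow hf _)
  rw [← pow_mul, ← pow_mul] at this
  obtain ⟨M, rfl⟩ : ∃ M, N = M + 1 := ⟨N - 1, by omega⟩
  have e : (M + 1) * r + (M + 1 - 1) + 1 = (M + 1) * (r + 1) := by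
    rw [Nat.add_sub_cancel]; ring
  rw [e]
  refine (?_ : I ^ (M + 1) * J ^ ((M + 1) * r) ≤ _) this
  rw [pow_succ', mul_assoc]
  refine Ideal.mul_mono le_rfl ?_
  calc _ ≤ J ^ M * J ^ ((M + 1) * r) := Ideal.mul_mono (Ideal.pow_right_mono hIJ _) le_rfl
    _ = _ := by rw [← pow_add]; congr 1; simp; ring

section charts
open scoped Pointwise
variable {k : Type*} [Field k]

/-- dehomogenization: set the variable `t` to `1`. -/
noncomputable def chartMap (k : Type*) [Field k] (t : Fin 2) :
    MvPolynomial (Fin 2) k →ₐ[k] Polynomial k :=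
  aeval (fun j => if j = t then 1 else Polynomial.X)

/-- homogenization in degree `m`. -/
noncomputable def homogMap (k : Type*) [Field k] (t : Fin 2) (m : ℕ) :
    Polynomial k →ₗ[k] MvPolynomial (Fin 2) k :=
  ∑ i ∈ Finset.range (m + 1),
    (Polynomial.lcoeff k i).smulRight ((X (1 - t)) ^ i * (X t) ^ (m - i))

lemma homogMap_apply (t : Fin 2) (m : ℕ) (q : Polynomial k) :
    homogMap k t m q = ∑ i ∈ Finset.range (m + 1),
      q.coeff i • ((X (1 - t)) ^ i * (X t) ^ (m - i) : MvPolynomial (Fin 2) k) := by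
  simp [homogMap, LinearMap.sum_apply]

lemma chartMap_X (t : Fin 2) : chartMap k t (X t) = 1 := by simp [chartMap]

lemma chartMap_X' (t : Fin 2) : chartMap k t (X (1 - t)) = Polynomial.X := by
  have : 1 - t ≠ t := by fin_cases t <;> decide
  simp [chartMap, this]

lemma homogMap_isHomogeneous (t : Fin 2) (m : ℕ) (q : Polynomial k) :
    (homogMap k t m q).IsHomogeneous m := by
  rw [homogMap_apply]
  refine IsHomogeneous.sum _ _ _ fun i hi => ?_
  have hi : i < m + 1 := Finset.mem_range.1 hi
  have h := ((isHomogeneous_X_pow (R := k) (1 - t) i).mul (isHomogeneous_X_pow t (m - i)))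
  rw [show i + (m - i) = m by omega] at h
  rw [smul_eq_C_mul]
  exact h.C_mul _

lemma chartMap_homogMap (t : Fin 2) (m : ℕ) (q : Polynomial k) (hq : q.natDegree ≤ m) :
    chartMap k t (homogMap k t m q) = q := by
  rw [homogMap_apply, map_sum]
  simp only [map_smul, map_mul, map_pow, chartMap_X, chartMap_X', one_pow, mul_one]
  conv_rhs => rw [q.as_sum_range' (m + 1) (by omega)]
  refine Finset.sum_congr rfl fun i _ => ?_
  rw [← Polynomial.C_mul_X_pow_eq_monomial, Polynomial.smul_eq_C_mul]

lemma homogMap_chartMap (t : Fin 2) (m : ℕ) (h : MvPolynomial (Fin 2) k) (hh : h.IsHomogeneous m) :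
    homogMap k t m (chartMap k t h) = h := by
  conv_rhs => rw [h.as_sum]
  conv_lhs => rw [h.as_sum]
  rw [map_sum, map_sum]
  refine Finset.sum_congr rfl fun d hd => ?_
  have hdeg : d.degree = m := by
    by_contra hne
    exact (mem_support_iff.1 hd) (hh.coeff_eq_zero hne)
  generalize coeff d h = c
  have hdeg2 : d (1 - t) + d t = m := by
    rw [← hdeg, Finsupp.degree_eq_sum, Fin.sum_univ_two]
    fin_cases t
    · simp [add_comm]
    · simp
  have hmon : monomial d c = c • ((X (1 - t)) ^ (d (1 - t)) * (X t) ^ (d t) :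
      MvPolynomial (Fin 2) k) := by
    rw [monomial_eq, smul_eq_C_mul, Finsupp.prod_fintype _ _ (by simp), Fin.prod_univ_two]
    fin_cases t
    · simp [mul_comm]
    · simp
  rw [hmon, map_smul, map_smul, map_mul, map_pow, map_pow, chartMap_X, chartMap_X', one_pow, mul_one,
    homogMap_apply]
  congr 1
  rw [Finset.sum_eq_single (d (1 - t))]
  · rw [Polynomial.coeff_X_pow_self, one_smul]
    congr 2; omega
  · intro b _ hb
    rw [Polynomial.coeff_X_pow, if_neg hb, zero_smul]
  · intro hb
    exact absurd (Finset.mem_range.2 (by omega)) hb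

lemma chartMap_inj (t : Fin 2) {m : ℕ} {h h' : MvPolynomial (Fin 2) k} (hh : h.IsHomogeneous m)
    (hh' : h'.IsHomogeneous m) (e : chartMap k t h = chartMap k t h') : h = h' := by
  rw [← homogMap_chartMap t m h hh, e, homogMap_chartMap t m h' hh']

lemma homog_fin (m : ℕ) : Module.Finite k (homogeneousSubmodule (Fin 2) k m) ∧
    Module.finrank k (homogeneousSubmodule (Fin 2) k m) ≤ m + 1 := by
  classical
  set s : Finset (MvPolynomial (Fin 2) k) :=
    (Finset.range (m + 1)).image (fun i => ((X (1 - 0)) ^ i * (X 0) ^ (m - i))) with hs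
  have hle : homogeneousSubmodule (Fin 2) k m ≤ Submodule.span k (s : Set (MvPolynomial (Fin 2) k)) := by
    intro h hh
    rw [← homogMap_chartMap 0 m h hh, homogMap_apply]
    refine sum_mem fun i hi => Submodule.smul_mem _ _ (Submodule.subset_span ?_)
    simp only [hs, Finset.coe_image]
    exact ⟨i, hi, rfl⟩
  have : Module.Finite k (Submodule.span k (s : Set (MvPolynomial (Fin 2) k))) :=
    Module.Finite.span_finset k s
  refine ⟨Submodule.finiteDimensional_of_le hle, ?_⟩
  refine (Submodule.finrank_mono hle).trans ((finrank_span_finset_le_card s).trans ?_)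
  exact Finset.card_image_le.trans (by simp)

lemma comp_dvd (t : Fin 2) (p : Polynomial k) (E : ℕ → ℕ) (hE : Antitone E)
    (S : Set (MvPolynomial (Fin 2) k))
    (hS : ∀ s ∈ S, ∃ b, s.IsHomogeneous b ∧ p ^ E b ∣ chartMap k t s)
    (g : MvPolynomial (Fin 2) k) (hg : g ∈ Ideal.span S) (m : ℕ) :
    p ^ E m ∣ chartMap k t (homogeneousComponent m g) := by
  induction hg using Submodule.span_induction generalizing m with
  | mem s hs =>
    obtain ⟨b, hb, hd⟩ := hS s hs
    rw [homogeneousComponent_of_mem hb]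
    split_ifs with h
    · rw [h]; exact hd
    · simp
  | zero => simp
  | add x y _ _ hx hy => rw [map_add, map_add]; exact dvd_add (hx m) (hy m)
  | smul a x _ hx =>
    rw [smul_eq_mul]
    conv_rhs => rw [← sum_homogeneousComponent a, ← sum_homogeneousComponent x]
    rw [Finset.sum_mul_sum, map_sum, map_sum]
    refine Finset.dvd_sum fun i _ => ?_
    rw [map_sum, map_sum]
    refine Finset.dvd_sum fun j _ => ?_
    rw [homogeneousComponent_of_mem
      ((homogeneousComponent_isHomogeneous i a).mul (homogeneousComponent_isHomogeneous j x))]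
    split_ifs with h
    · rw [map_mul, h]
      exact ((pow_dvd_pow p (hE (Nat.le_add_left j i))).trans (hx j)).mul_left _
    · simp

lemma pow_dvd_of_mem (t : Fin 2) (p : Polynomial k) (ρ lam : ℝ) (hρ : 0 ≤ ρ)
    (S : Set (MvPolynomial (Fin 2) k))
    (hS : ∀ s ∈ S, ∃ b : ℕ, s.IsHomogeneous b ∧ p ^ ⌈lam - ρ * b⌉₊ ∣ chartMap k t s)
    (n : ℕ) (m : ℕ) (g : MvPolynomial (Fin 2) k) (hg : g ∈ Ideal.span S ^ n)
    (hgm : g.IsHomogeneous m) :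
    p ^ ⌈n * lam - ρ * m⌉₊ ∣ chartMap k t g := by
  have hSn : ∀ n : ℕ, ∀ s ∈ S ^ n, ∃ b : ℕ, s.IsHomogeneous b ∧
      p ^ ⌈n * lam - ρ * b⌉₊ ∣ chartMap k t s := by
    intro n
    induction n with
    | zero =>
      intro s hs
      rw [pow_zero, Set.mem_one] at hs
      subst hs
      exact ⟨0, isHomogeneous_one _ _, by simp⟩
    | succ n ih =>
      intro s hs
      rw [pow_succ] at hs
      obtain ⟨u, hu, v, hv, rfl⟩ := Set.mem_mul.1 hs
      obtain ⟨b, hb, hb'⟩ := ih u hu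
      obtain ⟨c, hc, hc'⟩ := hS v hv
      refine ⟨b + c, hb.mul hc, ?_⟩
      rw [map_mul]
      refine dvd_trans ?_ (mul_dvd_mul hb' hc')
      rw [← pow_add]
      refine pow_dvd_pow _ (le_trans (Nat.ceil_mono ?_) (Nat.ceil_add_le _ _))
      push_cast; linarith
  have h1 : g ∈ Ideal.span (S ^ n) := by
    have : Ideal.span S ^ n = Ideal.span (S ^ n) := Submodule.span_pow S n
    rwa [this] at hg
  have := comp_dvd t p (fun b => ⌈n * lam - ρ * b⌉₊) (by
    intro b c hbc
    apply Nat.ceil_mono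
    have : (b : ℝ) ≤ c := by exact_mod_cast hbc
    nlinarith) (S ^ n) (hSn n) g h1 m
  rwa [homogeneousComponent_eq_self hgm] at this

end charts

lemma sep_lemma {ι : Type*} (s : Finset ι) (x y : ι → ℤ)
    (h : ∀ i ∈ s, ∀ j ∈ s, ∀ a b : ℕ, 0 < a + b → a * x i + b * x j ≤ 0 →
      0 < a * y i + b * y j) :
    ∃ ρ : ℝ, 0 < ρ ∧ ∃ η : ℝ, 0 < η ∧ ∀ i ∈ s, η ≤ ρ * x i + y i := by
  classical
  obtain ⟨ρ, hlo, hhi⟩ := Order.exists_between_finsets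
    (insert (0 : ℝ) ((s.filter (fun i => 0 < x i)).image (fun i => -(y i : ℝ) / x i)))
    ((s.filter (fun i => x i < 0)).image (fun i => (y i : ℝ) / (-x i))) (by
      intro u hu v hv
      obtain ⟨j, hj, rfl⟩ := Finset.mem_image.1 hv
      obtain ⟨hjs, hxj⟩ := Finset.mem_filter.1 hj
      have hxj' : (0 : ℝ) < -x j := by
        have : (x j : ℝ) < 0 := by exact_mod_cast hxj
        linarith
      rcases Finset.mem_insert.1 hu with rfl | hu
      · have := h j hjs j hjs 1 0 (by norm_num) (by simp; omega)
        have h2 : (0 : ℤ) < y j := by simpa using this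
        have h3 : (0 : ℝ) < y j := by exact_mod_cast h2
        positivity
      · obtain ⟨i, hi, rfl⟩ := Finset.mem_image.1 hu
        obtain ⟨his, hxi⟩ := Finset.mem_filter.1 hi
        have hxi' : (0 : ℝ) < x i := by exact_mod_cast hxi
        have := h i his j hjs (-x j).toNat (x i).toNat (by omega) (by
          rw [Int.toNat_of_nonneg (by omega), Int.toNat_of_nonneg (by omega)]
          apply le_of_eq; ring)
        rw [Int.toNat_of_nonneg (by omega), Int.toNat_of_nonneg (by omega)] at this
        have h3 : (0 : ℝ) < -x j * y i + x i * y j := by exact_mod_cast this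
        rw [div_lt_div_iff₀ hxi' hxj']
        linarith)
  have hρ : 0 < ρ := hlo 0 (Finset.mem_insert_self _ _)
  have hpos : ∀ i ∈ s, 0 < ρ * x i + y i := by
    intro i hi
    rcases lt_trichotomy (x i) 0 with hx | hx | hx
    · have h1 := hhi _ (Finset.mem_image_of_mem _ (Finset.mem_filter.2 ⟨hi, hx⟩))
      have hx' : (0 : ℝ) < -x i := by
        have : (x i : ℝ) < 0 := by exact_mod_cast hx
        linarith
      rw [lt_div_iff₀ hx'] at h1
      linarith
    · have := h i hi i hi 1 0 (by norm_num) (by simp; omega)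
      have h2 : (0 : ℤ) < y i := by simpa using this
      have h3 : (0 : ℝ) < y i := by exact_mod_cast h2
      simp [hx, h3]
    · have h1 := hlo _ (Finset.mem_insert_of_mem (Finset.mem_image_of_mem _
        (Finset.mem_filter.2 ⟨hi, hx⟩)))
      have hx' : (0 : ℝ) < x i := by exact_mod_cast hx
      rw [div_lt_iff₀ hx'] at h1
      linarith
  refine ⟨ρ, hρ, ?_⟩
  by_cases hs : s.Nonempty
  · refine ⟨s.inf' hs (fun i => ρ * x i + y i), ?_, fun i hi => Finset.inf'_le _ hi⟩
    rw [Finset.lt_inf'_iff]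
    exact hpos
  · rw [Finset.not_nonempty_iff_eq_empty] at hs
    exact ⟨1, one_pos, by simp [hs]⟩

lemma chain_lemma {k V : Type*} [Field k] [AddCommGroup V] [Module k V] (U : ℕ → Submodule k V)
    (hfin : ∀ i, FiniteDimensional k (U i)) (q : ℕ) (h : ∀ i < q, U (i + 1) < U i) :
    Module.finrank k (U q) + q ≤ Module.finrank k (U 0) := by
  induction q with
  | zero => simp
  | succ q ih =>
    have h1 := ih fun i hi => h i (by omega)
    have := hfin q
    have h2 := Submodule.finrank_lt_finrank_of_lt (h q (by omega))
    omega

section main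
variable {k : Type*} [Field k]

lemma polyPiece_fin (J : Ideal (MvPolynomial (Fin 2) k)) (m : ℕ) :
    FiniteDimensional k (polyPiece k J m) :=
  have := (homog_fin (k := k) m).1
  Submodule.finiteDimensional_of_le (inf_le_right : polyPiece k J m ≤ _)

lemma polyPiece_finrank_le (J : Ideal (MvPolynomial (Fin 2) k)) (m : ℕ) :
    Module.finrank k (polyPiece k J m) ≤ m + 1 :=
  have := (homog_fin (k := k) m).1
  (Submodule.finrank_mono (inf_le_right : polyPiece k J m ≤ _)).trans (homog_fin (k := k) m).2

lemma dim_gap (t : Fin 2) (J1 J2 : Ideal (MvPolynomial (Fin 2) k)) (h12 : J1 ≤ J2)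
    (p : Polynomial k) (hp : Prime p) (F : MvPolynomial (Fin 2) k) (D m q e a : ℕ)
    (hF : F ∈ J2) (hFD : F.IsHomogeneous D) (ha : emultiplicity p (chartMap k t F) = a)
    (h1 : ∀ g ∈ J1, g.IsHomogeneous m → p ^ e ∣ chartMap k t g)
    (hq : a + q ≤ e) (hm : D + q * p.natDegree ≤ m) :
    Module.finrank k (polyPiece k J1 m) + q ≤ Module.finrank k (polyPiece k J2 m) := by
  let U : ℕ → Submodule k (MvPolynomial (Fin 2) k) := fun i =>
    polyPiece k J2 m ⊓ ((Ideal.span {p ^ (a + i)}).restrictScalars k).comap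
      (chartMap k t).toLinearMap
  have hU : ∀ i g, g ∈ U i ↔ g ∈ polyPiece k J2 m ∧ p ^ (a + i) ∣ chartMap k t g := by
    intro i g
    simp [U, Ideal.mem_span_singleton]
  have hle : ∀ i, U i ≤ polyPiece k J2 m := fun i => inf_le_left
  have hf2 := polyPiece_fin J2 m
  have hfin : ∀ i, FiniteDimensional k (U i) := fun i => Submodule.finiteDimensional_of_le (hle i)
  have hc := chain_lemma U hfin q (by
    intro i hi
    rw [SetLike.lt_iff_le_and_exists]
    constructor
    · intro g hg
      rw [hU] at hg ⊢
      exact ⟨hg.1, (pow_dvd_pow p (by omega)).trans hg.2⟩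
    · have hdeg : i * p.natDegree ≤ m - D := by
        have : i * p.natDegree ≤ q * p.natDegree := Nat.mul_le_mul_right _ hi.le
        omega
      have hφ : chartMap k t (F * homogMap k t (m - D) (p ^ i)) = chartMap k t F * p ^ i := by
        rw [map_mul, chartMap_homogMap _ _ _ (Polynomial.natDegree_pow_le.trans hdeg)]
      have hmul : emultiplicity p (chartMap k t F * p ^ i) = ((a + i : ℕ) : ℕ∞) := by
        rw [emultiplicity_mul hp, ha, emultiplicity_pow_self_of_prime hp]; simp
      refine ⟨F * homogMap k t (m - D) (p ^ i), ?_, ?_⟩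
      · rw [hU, hφ]
        refine ⟨⟨Ideal.mul_mem_right _ _ hF, ?_⟩, ?_⟩
        · have := hFD.mul (homogMap_isHomogeneous t (m - D) (p ^ i))
          rwa [show D + (m - D) = m by omega] at this
        · exact pow_dvd_of_le_emultiplicity hmul.ge
      · rw [hU, hφ]
        rintro ⟨-, hd⟩
        have := le_emultiplicity_of_pow_dvd hd
        rw [hmul] at this
        have : a + (i + 1) ≤ a + i := by exact_mod_cast this
        omega)
  have hle1 : polyPiece k J1 m ≤ U q := by
    intro g hg
    rw [hU]
    exact ⟨⟨h12 hg.1, hg.2⟩, (pow_dvd_pow p hq).trans (h1 g hg.1 hg.2)⟩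
  have := hfin q
  have e1 := Submodule.finrank_mono hle1
  have e2 := Submodule.finrank_mono (hle 0)
  omega

lemma asymp_gap (t : Fin 2) (I1 I2 : Ideal (MvPolynomial (Fin 2) k)) (h12 : I1 ≤ I2)
    (s : Finset (MvPolynomial (Fin 2) k)) (hs : I1 = Ideal.span s)
    (deg : MvPolynomial (Fin 2) k → ℕ)
    (hs0 : ∀ g ∈ s, g ≠ 0) (hsh : ∀ g ∈ s, g.IsHomogeneous (deg g))
    (f : MvPolynomial (Fin 2) k) (d : ℕ) (hf : f ∈ I2) (hf0 : f ≠ 0) (hfd : f.IsHomogeneous d)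
    (p : Polynomial k) (hp : Prime p)
    (hneg : ∀ N : ℕ, 0 < N → ∀ g ∈ I1 ^ N, g.IsHomogeneous (N * d) →
      emultiplicity p (chartMap k t (f ^ N)) < emultiplicity p (chartMap k t g)) :
    ∃ x : ℝ, 0 ≤ x ∧ ∃ δ : ℝ, 0 < δ ∧ ∀ᶠ n : ℕ in atTop,
      (Module.finrank k (polyPiece k (I1 ^ n) (⌊x * n⌋).toNat) : ℝ) + δ * n ≤
        (Module.finrank k (polyPiece k (I2 ^ n) (⌊x * n⌋).toNat) : ℝ) := by
  have hne : ∀ g : MvPolynomial (Fin 2) k, g ≠ 0 → ∀ b, g.IsHomogeneous b → chartMap k t g ≠ 0 := by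
    intro g hg b hb h
    exact hg (chartMap_inj t hb (isHomogeneous_zero _ _ b) (by simpa using h))
  have hfm : ∀ g : MvPolynomial (Fin 2) k, g ≠ 0 → ∀ b, g.IsHomogeneous b →
      emultiplicity p (chartMap k t g) = (multiplicity p (chartMap k t g) : ℕ∞) := by
    intro g hg b hb
    exact (FiniteMultiplicity.of_prime_left hp (hne g hg b hb)).emultiplicity_eq_multiplicity
  set a : ℕ := multiplicity p (chartMap k t f) with ha
  have hfa := hfm f hf0 d hfd
  rw [← ha] at hfa
  obtain ⟨ρ, hρ, η, hη, hsep⟩ := sep_lemma s (fun g => (deg g : ℤ) - d)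
    (fun g => (multiplicity p (chartMap k t g) : ℤ) - a) (by
      intro g hg g' hg' u v huv hx
      have hdle : u * deg g + v * deg g' ≤ (u + v) * d := by
        have : ((u * deg g + v * deg g' : ℕ) : ℤ) ≤ ((u + v) * d : ℕ) := by
          push_cast; linarith
        exact_mod_cast this
      have hmem : g ^ u * g' ^ v * X t ^ ((u + v) * d - (u * deg g + v * deg g')) ∈ I1 ^ (u + v) := by
        apply Ideal.mul_mem_right
        rw [pow_add]
        have hI : ∀ g ∈ s, g ∈ I1 := fun g hg => hs ▸ Ideal.subset_span hg
        exact Ideal.mul_mem_mul (Ideal.pow_mem_pow (hI g hg) _) (Ideal.pow_mem_pow (hI g' hg') _)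
      have hhom : (g ^ u * g' ^ v * X t ^ ((u + v) * d - (u * deg g + v * deg g'))).IsHomogeneous
          ((u + v) * d) := by
        have := (((hsh g hg).pow u).mul ((hsh g' hg').pow v)).mul
          (isHomogeneous_X_pow t ((u + v) * d - (u * deg g + v * deg g')))
        convert this using 1
        rw [mul_comm (deg g), mul_comm (deg g')]; omega
      have := hneg (u + v) huv _ hmem hhom
      simp only [map_mul, map_pow, chartMap_X, one_pow, mul_one, emultiplicity_mul hp,
        emultiplicity_pow hp] at this
      rw [hfa, hfm g (hs0 g hg) _ (hsh g hg), hfm g' (hs0 g' hg') _ (hsh g' hg')] at this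
      have h2 : (u + v) * a < u * multiplicity p (chartMap k t g) +
        v * multiplicity p (chartMap k t g') := by exact_mod_cast this
      have h3 : (((u + v) * a : ℕ) : ℤ) < (u * multiplicity p (chartMap k t g) +
        v * multiplicity p (chartMap k t g') : ℕ) := by exact_mod_cast h2
      push_cast at h3
      linarith)
  set lam : ℝ := ρ * d + a + η with hlam
  have hpow := pow_dvd_of_mem t p ρ lam hρ.le (s : Set (MvPolynomial (Fin 2) k)) (by
    intro g hg
    refine ⟨deg g, hsh g hg, ?_⟩
    refine (pow_dvd_pow p ?_).trans (pow_multiplicity_dvd p _)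
    rw [Nat.ceil_le]
    have := hsep g hg
    push_cast at this
    rw [hlam]; linarith)
  set ε : ℝ := η / (2 * ρ) with hε
  have hε0 : 0 < ε := by positivity
  have hρε : ρ * ε = η / 2 := by rw [hε]; field_simp
  set δ : ℝ := min (η / 2) (ε / (2 * (p.natDegree + 1))) with hδ
  have hδ0 : 0 < δ := by rw [hδ]; positivity
  have hδ1 : δ ≤ η / 2 := min_le_left _ _
  have hδ2 : δ * p.natDegree ≤ ε / 2 := by
    have h1 : δ ≤ ε / (2 * (p.natDegree + 1)) := min_le_right _ _
    have h2 : δ * (2 * (p.natDegree + 1)) ≤ ε := by rwa [le_div_iff₀ (by positivity)] at h1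
    nlinarith
  refine ⟨d + ε, by positivity, δ / 2, by positivity, ?_⟩
  have e1 : ∀ᶠ n : ℕ in atTop, 2 / ε ≤ (n : ℝ) :=
    tendsto_natCast_atTop_atTop.eventually_ge_atTop _
  have e2 : ∀ᶠ n : ℕ in atTop, 2 / δ ≤ (n : ℝ) :=
    tendsto_natCast_atTop_atTop.eventually_ge_atTop _
  filter_upwards [e1, e2] with n hn1 hn2
  rw [div_le_iff₀ hε0] at hn1
  rw [div_le_iff₀ hδ0] at hn2
  have hx0 : 0 ≤ (d + ε) * n := by positivity
  have hmf : (⌊((d : ℝ) + ε) * n⌋).toNat = ⌊((d : ℝ) + ε) * n⌋₊ := rfl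
  rw [hmf]
  set m : ℕ := ⌊((d : ℝ) + ε) * n⌋₊ with hm
  have hm1 : (m : ℝ) ≤ (d + ε) * n := Nat.floor_le hx0
  have hm2 : (d + ε) * n < m + 1 := Nat.lt_floor_add_one _
  have hq1 : (⌊δ * n⌋₊ : ℝ) ≤ δ * n := Nat.floor_le (by positivity)
  have hq2 : δ * n < ⌊δ * n⌋₊ + 1 := Nat.lt_floor_add_one _
  have key := dim_gap t (I1 ^ n) (I2 ^ n) (Ideal.pow_right_mono h12 n) p hp (f ^ n) (d * n) m
    ⌊δ * n⌋₊ ⌈n * lam - ρ * m⌉₊ (n * a) (Ideal.pow_mem_pow hf n) (hfd.pow n)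
    (by rw [map_pow, emultiplicity_pow hp, hfa]; simp)
    (fun g hg hgm => hpow n m g (hs ▸ hg) hgm)
    (by
      have h1 := Nat.le_ceil ((n : ℝ) * lam - ρ * m)
      have h2 : ρ * m ≤ ρ * ((d + ε) * n) := mul_le_mul_of_nonneg_left hm1 hρ.le
      have h3 : ρ * ((d + ε) * n) = ρ * d * n + η / 2 * n := by rw [← hρε]; ring
      have h4 : δ * n ≤ η / 2 * n := by gcongr
      have : ((n * a + ⌊δ * n⌋₊ : ℕ) : ℝ) ≤ (⌈(n : ℝ) * lam - ρ * m⌉₊ : ℝ) := by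
        push_cast
        rw [hlam] at h1 ⊢
        nlinarith
      exact_mod_cast this)
    (by
      have h1 : (⌊δ * n⌋₊ : ℝ) * p.natDegree ≤ ε / 2 * n := by
        calc (⌊δ * n⌋₊ : ℝ) * p.natDegree ≤ δ * n * p.natDegree := by gcongr
          _ = δ * p.natDegree * n := by ring
          _ ≤ ε / 2 * n := by gcongr
      have : ((d * n + ⌊δ * n⌋₊ * p.natDegree : ℕ) : ℝ) ≤ m := by
        push_cast
        nlinarith
      exact_mod_cast this)
  have key' : (Module.finrank k (polyPiece k (I1 ^ n) m) : ℝ) + (⌊δ * n⌋₊ : ℝ) ≤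
      (Module.finrank k (polyPiece k (I2 ^ n) m) : ℝ) := by exact_mod_cast key
  nlinarith

end main

section final
variable {k : Type*} [Field k]

lemma limsup_contra (u v : ℕ → ℝ) (δ C : ℝ) (hδ : 0 < δ) (hu : ∀ n, 0 ≤ u n)
    (hv : ∀ᶠ n in atTop, v n ≤ C)
    (h : ∀ᶠ n in atTop, u n + δ ≤ v n) : limsup u atTop ≠ limsup v atTop := by
  intro e
  have hub : ∀ᶠ n in atTop, u n ≤ C := by
    filter_upwards [hv, h] with n h1 h2
    linarith
  have hu1 : IsBoundedUnder (· ≤ ·) atTop u := isBoundedUnder_of_eventually_le hub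
  have hu2 : IsBoundedUnder (· ≥ ·) atTop u :=
    isBoundedUnder_of_eventually_ge (Eventually.of_forall hu)
  have h1 := limsup_add_const atTop u δ hu1 hu2.isCoboundedUnder_le
  have h2 : limsup (fun n => u n + δ) atTop ≤ limsup v atTop := by
    refine limsup_le_limsup h ?_ (isBoundedUnder_of_eventually_le hv)
    refine IsBoundedUnder.isCoboundedUnder_le ?_
    exact isBoundedUnder_of_eventually_ge (a := 0)
      (Eventually.of_forall fun n => by have := hu n; linarith)
  rw [h1] at h2
  linarith

lemma homogMap_mem (t : Fin 2) (r : ℕ) (q : Polynomial k) :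
    homogMap k t r q ∈ (Ideal.span {X 0, X 1} : Ideal (MvPolynomial (Fin 2) k)) ^ r := by
  rw [homogMap_apply]
  refine sum_mem fun i hi => ?_
  have hi : i < r + 1 := Finset.mem_range.1 hi
  have hX : ∀ j : Fin 2, (X j : MvPolynomial (Fin 2) k) ∈
      (Ideal.span {X 0, X 1} : Ideal (MvPolynomial (Fin 2) k)) := by
    intro j
    apply Ideal.subset_span
    fin_cases j <;> simp
  rw [smul_eq_C_mul]
  apply Ideal.mul_mem_left
  have := Ideal.mul_mem_mul (Ideal.pow_mem_pow (hX (1 - t)) i) (Ideal.pow_mem_pow (hX t) (r - i))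
  rwa [← pow_add, show i + (r - i) = r by omega] at this

lemma chart_lift (t : Fin 2) (K : Ideal (MvPolynomial (Fin 2) k)) (D : ℕ) (z : Polynomial k)
    (hz : z ∈ Ideal.span (chartMap k t '' {g | g ∈ K ∧ g.IsHomogeneous D})) :
    ∃ c0 : ℕ, ∀ c, c0 ≤ c → ∃ h, h ∈ K * (Ideal.span {X 0, X 1}) ^ c ∧ h.IsHomogeneous (D + c) ∧
      chartMap k t h = z := by
  induction hz using Submodule.span_induction with
  | mem z hz =>
    obtain ⟨g, ⟨hg, hgD⟩, rfl⟩ := hz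
    refine ⟨0, fun c _ => ⟨g * X t ^ c, Ideal.mul_mem_mul hg (Ideal.pow_mem_pow ?_ c),
      hgD.mul (isHomogeneous_X_pow t c), by simp [chartMap_X]⟩⟩
    apply Ideal.subset_span
    fin_cases t <;> simp
  | zero => exact ⟨0, fun c _ => ⟨0, zero_mem _, isHomogeneous_zero _ _ _, by simp⟩⟩
  | add x y _ _ hx hy =>
    obtain ⟨c1, h1⟩ := hx
    obtain ⟨c2, h2⟩ := hy
    refine ⟨c1 + c2, fun c hc => ?_⟩
    obtain ⟨u, hu, hu', hu''⟩ := h1 c (by omega)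
    obtain ⟨v, hv, hv', hv''⟩ := h2 c (by omega)
    exact ⟨u + v, add_mem hu hv, hu'.add hv', by rw [map_add, hu'', hv'']⟩
  | smul a x _ hx =>
    obtain ⟨c1, h1⟩ := hx
    refine ⟨c1 + a.natDegree, fun c hc => ?_⟩
    obtain ⟨u, hu, hu', hu''⟩ := h1 (c - a.natDegree) (by omega)
    refine ⟨u * homogMap k t a.natDegree a, ?_, ?_, ?_⟩
    · have := Ideal.mul_mem_mul hu (homogMap_mem t a.natDegree a)
      rwa [mul_assoc, ← pow_add, show c - a.natDegree + a.natDegree = c by omega] at this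
    · have := hu'.mul (homogMap_isHomogeneous t a.natDegree a)
      rwa [show D + (c - a.natDegree) + a.natDegree = D + c by omega] at this
    · rw [map_mul, hu'', chartMap_homogMap _ _ _ le_rfl, smul_eq_mul, mul_comm]

lemma chart_conclusion (t : Fin 2) (I : Ideal (MvPolynomial (Fin 2) k))
    (f : MvPolynomial (Fin 2) k) (d : ℕ) (hf0 : f ≠ 0) (hfd : f.IsHomogeneous d)
    (hgood : ∀ p : Polynomial k, Prime p → ∃ N : ℕ, 0 < N ∧ ∃ g ∈ I ^ N, g.IsHomogeneous (N * d) ∧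
      emultiplicity p (chartMap k t g) ≤ emultiplicity p (chartMap k t (f ^ N))) :
    ∃ N c : ℕ, 0 < N ∧ X t ^ c * f ^ N ∈ I ^ N * (Ideal.span {X 0, X 1}) ^ c := by
  classical
  have hφf : chartMap k t f ≠ 0 := fun h =>
    hf0 (chartMap_inj t hfd (isHomogeneous_zero _ _ d) (by simpa using h))
  have hgood' : ∀ p : Polynomial k, ∃ N : ℕ, 0 < N ∧ ∃ g ∈ I ^ N, g.IsHomogeneous (N * d) ∧
      (Prime p → emultiplicity p (chartMap k t g) ≤ emultiplicity p (chartMap k t (f ^ N))) := by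
    intro p
    by_cases hp : Prime p
    · obtain ⟨N, hN, g, hg, hgd, h⟩ := hgood p hp
      exact ⟨N, hN, g, hg, hgd, fun _ => h⟩
    · exact ⟨1, one_pos, 0, zero_mem _, isHomogeneous_zero _ _ _, fun h => absurd h hp⟩
  choose N hN G hG hGd hGp using hgood'
  have hX := Polynomial.prime_X (R := k)
  have hG0 : chartMap k t (G Polynomial.X) ≠ 0 := by
    intro h
    have h1 := hGp _ hX
    rw [h, emultiplicity_zero, top_le_iff] at h1
    have h2 : FiniteMultiplicity Polynomial.X (chartMap k t (f ^ N Polynomial.X)) := by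
      apply FiniteMultiplicity.of_prime_left hX
      rw [map_pow]; exact pow_ne_zero _ hφf
    exact (finiteMultiplicity_iff_emultiplicity_ne_top.1 h2) h1
  set T := (UniqueFactorizationMonoid.normalizedFactors (chartMap k t (G Polynomial.X))).toFinset with hT
  set M : ℕ := N Polynomial.X * ∏ q ∈ T, N q with hM
  have hMpos : 0 < M := by
    rw [hM]; exact Nat.mul_pos (hN _) (Finset.prod_pos fun q _ => hN q)
  have hpowmem : ∀ q, N q ∣ M → ∃ e, M = N q * e ∧ G q ^ e ∈ I ^ M ∧ (G q ^ e).IsHomogeneous (M * d) := by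
    rintro q ⟨e, he⟩
    refine ⟨e, he, ?_, ?_⟩
    · rw [he, pow_mul]; exact Ideal.pow_mem_pow (hG q) e
    · have := (hGd q).pow e
      rwa [show N q * d * e = M * d by rw [he]; ring] at this
  set 𝔞 : Ideal (Polynomial k) :=
    Ideal.span (chartMap k t '' {g | g ∈ I ^ M ∧ g.IsHomogeneous (M * d)}) with h𝔞
  have hin : ∀ g, g ∈ I ^ M → g.IsHomogeneous (M * d) →
      Submodule.IsPrincipal.generator 𝔞 ∣ chartMap k t g := by
    intro g hg hgd
    rw [← Submodule.IsPrincipal.mem_iff_generator_dvd]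
    exact Ideal.subset_span ⟨g, ⟨hg, hgd⟩, rfl⟩
  have hX_dvd : N Polynomial.X ∣ M := ⟨_, hM⟩
  have hb0 : Submodule.IsPrincipal.generator 𝔞 ≠ 0 := by
    obtain ⟨e, he, h1, h2⟩ := hpowmem _ hX_dvd
    have := hin _ h1 h2
    intro h
    rw [h, zero_dvd_iff, map_pow] at this
    exact pow_ne_zero _ hG0 this
  have hmem : chartMap k t (f ^ M) ∈ 𝔞 := by
    rw [Submodule.IsPrincipal.mem_iff_generator_dvd,
      UniqueFactorizationMonoid.dvd_iff_emultiplicity_le hb0]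
    intro p hp
    by_cases hpd : p ∣ chartMap k t (G Polynomial.X)
    · obtain ⟨q, hq, hpq⟩ := UniqueFactorizationMonoid.exists_mem_normalizedFactors_of_dvd hG0
        hp.irreducible hpd
      have hqT : q ∈ T := by rw [hT]; exact Multiset.mem_toFinset.2 hq
      obtain ⟨e, he, h1, h2⟩ := hpowmem q ((Finset.dvd_prod_of_mem N hqT).mul_left _)
      have hqp : Prime q := hpq.prime hp
      refine (emultiplicity_le_emultiplicity_of_dvd_right (hin _ h1 h2)).trans ?_
      rw [emultiplicity_eq_of_associated_left hpq.symm, emultiplicity_eq_of_associated_left hpq.symm, he,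
        pow_mul, map_pow, map_pow _ (f ^ N q) e, emultiplicity_pow hqp, emultiplicity_pow hqp]
      gcongr
      exact hGp q hqp
    · obtain ⟨e, he, h1, h2⟩ := hpowmem _ hX_dvd
      refine (emultiplicity_le_emultiplicity_of_dvd_right (hin _ h1 h2)).trans ?_
      rw [map_pow, emultiplicity_pow hp, emultiplicity_eq_zero.2 hpd]
      simp
  obtain ⟨c, hc⟩ := chart_lift t (I ^ M) (M * d) _ hmem
  obtain ⟨h, h1, h2, h3⟩ := hc c le_rfl
  refine ⟨M, c, hMpos, ?_⟩
  have : X t ^ c * f ^ M = h := by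
    refine chartMap_inj t (m := M * d + c) ?_ h2 ?_
    · have := (isHomogeneous_X_pow (R := k) t c).mul (hfd.pow M)
      rwa [show c + d * M = M * d + c by ring] at this
    · rw [h3, map_mul, map_pow, chartMap_X, one_pow, one_mul]
  rw [this]; exact h1

lemma exists_gens (I : Ideal (MvPolynomial (Fin 2) k))
    (hhom : ∃ S : Set (MvPolynomial (Fin 2) k), I = Ideal.span S ∧
      ∀ s ∈ S, ∃ m : ℕ, s.IsHomogeneous m) :
    ∃ (s : Finset (MvPolynomial (Fin 2) k)) (deg : MvPolynomial (Fin 2) k → ℕ),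
      I = Ideal.span s ∧ (∀ g ∈ s, g ≠ 0) ∧ ∀ g ∈ s, g.IsHomogeneous (deg g) := by
  classical
  obtain ⟨S, hS, hh⟩ := hhom
  have hfg : (Submodule.span (MvPolynomial (Fin 2) k) S).FG := IsNoetherian.noetherian _
  obtain ⟨s, hsS, hs⟩ := (Submodule.fg_span_iff_fg_span_finset_subset S).1 hfg
  have : ∀ g : MvPolynomial (Fin 2) k, ∃ m : ℕ, g ∈ S → g.IsHomogeneous m := by
    intro g
    by_cases hg : g ∈ S
    · obtain ⟨m, hm⟩ := hh g hg
      exact ⟨m, fun _ => hm⟩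
    · exact ⟨0, fun h => absurd h hg⟩
  choose deg hdeg using this
  refine ⟨s.erase 0, deg, ?_, fun g hg => Finset.ne_of_mem_erase hg,
    fun g hg => hdeg g (hsS (Finset.mem_of_mem_erase hg))⟩
  rw [hS, Finset.coe_erase]
  unfold Ideal.span
  rw [hs, Submodule.span_sdiff_singleton_zero]

end final

/-- in `A = k[X,Y]`, if `I_1 ⊆ I_2` are homogeneous ideals whose
density functions `f_{A,{I_jⁿ}}(x) = lim_n dim_k((I_jⁿ)_{⌊xn⌋})/(n/2)` agree for
all `x ≥ 0`, then `I_1 ⊆ I_2` is a reduction, i.e. `I_2^{n+1} = I_1·I_2^n` for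
some `n` (equivalently, `I_2` is integral over `I_1`). -/
theorem equal_density_functions_implies_reduction
    (k : Type*) [Field k]
    (I1 I2 : Ideal (MvPolynomial (Fin 2) k)) (h12 : I1 ≤ I2)
    (hhom1 : ∃ S : Set (MvPolynomial (Fin 2) k), I1 = Ideal.span S ∧
      ∀ s ∈ S, ∃ m : ℕ, s.IsHomogeneous m)
    (hhom2 : ∃ S : Set (MvPolynomial (Fin 2) k), I2 = Ideal.span S ∧
      ∀ s ∈ S, ∃ m : ℕ, s.IsHomogeneous m)
    (heq : ∀ x : ℝ, 0 ≤ x →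
      Filter.limsup (fun n : ℕ =>
        (Module.finrank k ↥(polyPiece k (I1 ^ n) (⌊x * n⌋).toNat) : ℝ) /
          ((n : ℝ) / 2)) Filter.atTop =
      Filter.limsup (fun n : ℕ =>
        (Module.finrank k ↥(polyPiece k (I2 ^ n) (⌊x * n⌋).toNat) : ℝ) /
          ((n : ℝ) / 2)) Filter.atTop) :
    ∃ n : ℕ, I2 ^ (n + 1) = I1 * I2 ^ n := by
  obtain ⟨s1, deg1, hs1, hs10, hs1h⟩ := exists_gens I1 hhom1
  obtain ⟨s2, deg2, hs2, hs20, hs2h⟩ := exists_gens I2 hhom2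
  refine reduction_of_gens I1 I2 h12 s2 hs2 fun f hf => ?_
  have hf2 : f ∈ I2 := hs2 ▸ Ideal.subset_span hf
  have hchart : ∀ t : Fin 2, ∃ N c : ℕ, 0 < N ∧
      X t ^ c * f ^ N ∈ I1 ^ N * (Ideal.span {X 0, X 1}) ^ c := by
    intro t
    refine chart_conclusion t I1 f (deg2 f) (hs20 f hf) (hs2h f hf) ?_
    intro p hp
    by_contra hneg
    push Not at hneg
    obtain ⟨x, hx, δ, hδ, hgap⟩ := asymp_gap t I1 I2 h12 s1 hs1 deg1 hs10 hs1h f (deg2 f) hf2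
      (hs20 f hf) (hs2h f hf) p hp hneg
    refine limsup_contra _ _ (2 * δ) (2 * x + 2) (by positivity) (fun n => by positivity) ?_ ?_
      (heq x hx)
    · filter_upwards [eventually_ge_atTop 1] with n hn
      have hn' : (1 : ℝ) ≤ n := by exact_mod_cast hn
      rw [div_le_iff₀ (by positivity)]
      have h1 : ((Module.finrank k ↥(polyPiece k (I2 ^ n) (⌊x * n⌋).toNat) : ℕ) : ℝ) ≤
          ((⌊x * n⌋).toNat + 1 : ℕ) := by exact_mod_cast polyPiece_finrank_le _ _
      have h2 : (((⌊x * n⌋).toNat : ℕ) : ℝ) ≤ x * n := Nat.floor_le (a := x * n) (by positivity)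
      push_cast at h1
      nlinarith
    · filter_upwards [eventually_ge_atTop 1, hgap] with n hn hg
      have hn' : (1 : ℝ) ≤ n := by exact_mod_cast hn
      rw [le_div_iff₀ (by positivity), add_mul, div_mul_cancel₀ _ (by positivity)]
      linarith
  obtain ⟨N1, c1, hN1, h1⟩ := hchart 0
  obtain ⟨N2, c2, hN2, h2⟩ := hchart 1
  obtain ⟨r, hr⟩ := integral_of_charts I1 f (X 0) (X 1) (X_ne_zero 0) N1 N2 c1 c2 hN1 hN2 h1 h2
  exact ⟨r, hr I2 h12 hf2⟩
end
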